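/- Let f : 𝔻 → D ⊂ ℂ be a conformal map with f(0) = 0, f'(0) > 0. Define the Stolz cone S_r = {1 − ρe^{iθ} : 0 ≤ ρ ≤ r, −π/4 ≤ θ ≤ π/4} and the radial segment σ_r = [1−r, 1). Then there is a universal constant c < ∞ such that diam f(S_r) ≤ c · diam f(σ_r) for all r ∈ (0, 1). -/

import Mathlib

/-- The Stolz cone `S_r = {1 - ρ e^{iθ} : 0 ≤ ρ ≤ r, -π/4 ≤ θ ≤ π/4}`. -/
def stolzCone (r : ℝ) : Set ℂ :=
  {z | ∃ ρ θ : ℝ, 0 ≤ ρ ∧ ρ ≤ r ∧ -(Real.pi / 4) ≤ θ ∧ θ ≤ Real.pi / 4 ∧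
    z = 1 - ρ * Complex.exp (θ * Complex.I)}

/-- The radial segment `σ_r = [1 - r, 1)`. -/
def radialSeg (r : ℝ) : Set ℂ :=
  {z | ∃ s : ℝ, 1 - r ≤ s ∧ s < 1 ∧ z = (s : ℂ)}

open Metric Filter Topology

/-- **Bloch's theorem** with a non-optimal constant: the image of `ball c R` under a holomorphic
function contains a disc of radius `R * ‖deriv f c‖ / 96`. -/
theorem exists_ball_subset_image_ball_of_differentiableOn {f : ℂ → ℂ} {c : ℂ} {R : ℝ}
    (hf : DifferentiableOn ℂ f (ball c R)) (hR : 0 < R) :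
    ∃ w, ball w (R * ‖deriv f c‖ / 96) ⊆ f '' ball c R := by
  rcases eq_or_ne (deriv f c) 0 with h0 | h0
  · exact ⟨0, by simp [h0]⟩
  have hM : 0 < ‖deriv f c‖ := norm_pos_iff.2 h0
  have hf' : DifferentiableOn ℂ (deriv f) (ball c R) := hf.deriv isOpen_ball
  have hsub : closedBall c (R / 2) ⊆ ball c R := closedBall_subset_ball (by linarith)
  obtain ⟨p, hp, hmax⟩ := (isCompact_closedBall c (R / 2)).exists_isMaxOn
    ⟨c, mem_closedBall_self (by linarith)⟩
    (f := fun z => (R / 2 - dist z c) * ‖deriv f z‖)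
    (by
      have := hf'.continuousOn.mono hsub
      fun_prop)
  have hc : R / 2 * ‖deriv f c‖ ≤ (R / 2 - dist p c) * ‖deriv f p‖ := by
    simpa using hmax (mem_closedBall_self (by linarith : 0 ≤ R / 2))
  have hpc : dist p c ≤ R / 2 := hp
  have hpos : 0 < (R / 2 - dist p c) * ‖deriv f p‖ := lt_of_lt_of_le (by positivity) hc
  have hD : 0 < ‖deriv f p‖ := pos_of_mul_pos_right hpos (by linarith)
  have ht' : 0 < R / 2 - dist p c := pos_of_mul_pos_left hpos hD.le
  set D := ‖deriv f p‖ with hDdef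
  obtain ⟨t, ht⟩ : ∃ t, t = (R / 2 - dist p c) / 2 := ⟨_, rfl⟩
  have htpos : 0 < t := by linarith
  have hballsub : ball p t ⊆ ball c (R / 2) := ball_subset_ball' (by linarith)
  have hballR : ball p t ⊆ ball c R := (hballsub.trans ball_subset_closedBall).trans hsub
  have hsmall : closedBall p (t / 6) ⊆ ball p t := closedBall_subset_ball (by linarith)
  have hbound : ∀ z ∈ ball p t, ‖deriv f z‖ ≤ 2 * D := by
    intro z hz
    have h1 : (R / 2 - dist z c) * ‖deriv f z‖ ≤ (R / 2 - dist p c) * D :=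
      hmax (ball_subset_closedBall (hballsub hz))
    have h2 : t ≤ R / 2 - dist z c := by
      have := dist_triangle z p c
      have := mem_ball.1 hz
      linarith
    have h3 : t * ‖deriv f z‖ ≤ t * (2 * D) := by
      calc t * ‖deriv f z‖ ≤ (R / 2 - dist z c) * ‖deriv f z‖ := by gcongr
        _ ≤ (R / 2 - dist p c) * D := h1
        _ = t * (2 * D) := by rw [ht]; ring
    exact le_of_mul_le_mul_left h3 htpos
  have hosc : ∀ z ∈ closedBall p (t / 6), ‖deriv f z - deriv f p‖ ≤ D / 2 := by
    intro z hz
    have h1 := Complex.dist_le_div_mul_dist_of_mapsTo_ball (R₂ := 3 * D) (hf'.mono hballR)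
      (fun x hx => by
        rw [mem_closedBall, dist_eq_norm]
        have := norm_sub_le (deriv f x) (deriv f p)
        have := hbound x hx
        linarith) (hsmall hz)
    rw [dist_eq_norm] at h1
    calc ‖deriv f z - deriv f p‖ ≤ 3 * D / t * dist z p := h1
      _ ≤ 3 * D / t * (t / 6) := by gcongr; exact hz
      _ = D / 2 := by field_simp; norm_num
  have hdiff : ∀ z ∈ ball p t, DifferentiableAt ℂ f z := fun z hz =>
    hf.differentiableAt (isOpen_ball.mem_nhds (hballR hz))
  have hlip : ∀ z ∈ closedBall p (t / 6),
      ‖(f z - deriv f p * z) - (f p - deriv f p * p)‖ ≤ D / 2 * ‖z - p‖ := by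
    intro z hz
    refine (convex_closedBall p (t / 6)).norm_image_sub_le_of_norm_hasDerivWithin_le
      (f := fun z => f z - deriv f p * z) (f' := fun z => deriv f z - deriv f p)
      (fun x hx => ?_) hosc (mem_closedBall_self (by linarith)) hz
    have h := (hdiff x (hsmall hx)).hasDerivAt.sub ((hasDerivAt_id' x).const_mul (deriv f p))
    rw [mul_one] at h
    exact h.hasDerivWithinAt
  have hsphere : ∀ z ∈ sphere p (t / 6), D * t / 12 ≤ ‖f z - f p‖ := by
    intro z hz
    have hzp : ‖z - p‖ = t / 6 := by rw [← dist_eq_norm]; exact hz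
    have h1 := hlip z (sphere_subset_closedBall hz)
    have h2 := norm_sub_norm_le (deriv f p * (z - p)) (-((f z - deriv f p * z) -
      (f p - deriv f p * p)))
    rw [norm_neg, norm_mul, hzp] at h2
    rw [hzp] at h1
    have h3 : deriv f p * (z - p) - -((f z - deriv f p * z) - (f p - deriv f p * p))
        = f z - f p := by ring
    rw [h3] at h2
    linarith
  have hcl : DiffContOnCl ℂ f (ball p (t / 6)) := by
    refine DifferentiableOn.diffContOnCl_ball (U := ball p t) ?_ hsmall
    exact hf.mono hballR
  have hne : ∃ᶠ z in 𝓝 p, f z ≠ f p :=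
    ((hdiff p (mem_ball_self htpos)).hasDerivAt.eventually_ne
      (norm_pos_iff.1 hD)).frequently.filter_mono nhdsWithin_le_nhds
  have himg := hcl.ball_subset_image_closedBall (by linarith) hsphere hne
  refine ⟨f p, (ball_subset_ball ?_).trans (himg.trans (Set.image_mono (hsmall.trans hballR)))⟩
  have : t * D = (R / 2 - dist p c) * D / 2 := by rw [ht]; ring
  linarith

/-- A nonvanishing holomorphic function on a disc has a holomorphic logarithm. -/
theorem DifferentiableOn.exists_exp_eq_on_ball {g : ℂ → ℂ} {c : ℂ} {R : ℝ}
    (hg : DifferentiableOn ℂ g (ball c R)) (h0 : ∀ z ∈ ball c R, g z ≠ 0) :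
    ∃ h : ℂ → ℂ, DifferentiableOn ℂ h (ball c R) ∧ ∀ z ∈ ball c R, Complex.exp (h z) = g z := by
  rcases le_or_gt R 0 with hR | hR
  · exact ⟨0, by simp [ball_eq_empty.2 hR]⟩
  obtain ⟨H, hH⟩ := ((hg.deriv isOpen_ball).div hg h0).isExactOn_ball
  have hcR : c ∈ ball c R := mem_ball_self hR
  have hder : ∀ z ∈ ball c R, HasDerivAt (fun z => g z * Complex.exp (-H z)) 0 z := by
    intro z hz
    have h1 := (hg.differentiableAt (isOpen_ball.mem_nhds hz)).hasDerivAt.mul (hH z hz).neg.cexp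
    refine h1.congr_deriv ?_
    have := h0 z hz
    simp only [Pi.div_apply]
    field_simp
    ring
  have hconst : ∀ z ∈ ball c R, g z * Complex.exp (-H z) = g c * Complex.exp (-H c) := by
    intro z hz
    have := (convex_ball c R).norm_image_sub_le_of_norm_hasDerivWithin_le (C := 0)
      (fun x hx => (hder x hx).hasDerivWithinAt) (by simp) hcR hz
    simpa [sub_eq_zero] using this
  refine ⟨fun z => H z + (Complex.log (g c) - H c), fun z hz =>
    ((hH z hz).differentiableAt.add_const _).differentiableWithinAt, fun z hz => ?_⟩
  have h1 := hconst z hz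
  rw [Complex.exp_add, Complex.exp_sub, Complex.exp_log (h0 c hcR)]
  rw [Complex.exp_neg, Complex.exp_neg] at h1
  have := Complex.exp_ne_zero (H z)
  have := Complex.exp_ne_zero (H c)
  field_simp at h1 ⊢
  linear_combination -h1

/-- If `exp ∘ h` is injective on a disc, then `h` satisfies a universal derivative bound. -/
theorem norm_deriv_le_of_injOn_exp {h : ℂ → ℂ} {c : ℂ} {R : ℝ} (hR : 0 < R)
    (hd : DifferentiableOn ℂ h (ball c R))
    (hinj : Set.InjOn (fun z => Complex.exp (h z)) (ball c R)) :
    ‖deriv h c‖ ≤ 672 / R := by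
  by_contra! hlt
  obtain ⟨w, hw⟩ := exists_ball_subset_image_ball_of_differentiableOn hd hR
  have hrad : 7 < R * ‖deriv h c‖ / 96 := by
    rw [div_lt_iff₀ hR] at hlt
    linarith
  have hnorm : ‖2 * (Real.pi : ℂ) * Complex.I‖ < 7 := by
    simp only [norm_mul, Complex.norm_I, Complex.norm_real, Real.norm_eq_abs,
      abs_of_pos Real.pi_pos, Complex.norm_ofNat]
    linarith [Real.pi_lt_d2]
  obtain ⟨x, hx, hxw⟩ := hw (mem_ball_self (by linarith))
  obtain ⟨y, hy, hyw⟩ := hw (show w + 2 * Real.pi * Complex.I ∈ _ by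
    rw [mem_ball, dist_eq_norm, add_sub_cancel_left]; linarith)
  have hxy : x = y := hinj hx hy (by simp [hxw, hyw, Complex.exp_add])
  rw [← hxy, hxw] at hyw
  simp [Real.pi_ne_zero] at hyw

/-- An injective nonvanishing holomorphic function on the unit disc satisfies a Harnack inequality
on closed discs. -/
theorem norm_le_exp_mul_norm_of_injOn {g : ℂ → ℂ} (hg : DifferentiableOn ℂ g (ball 0 1))
    (hinj : Set.InjOn g (ball 0 1)) (h0 : ∀ z ∈ ball (0 : ℂ) 1, g z ≠ 0) {δ : ℝ} (hδ : 0 < δ)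
    {z w : ℂ} (hz : ‖z‖ ≤ 1 - δ) (hw : ‖w‖ ≤ 1 - δ) :
    ‖g z‖ ≤ Real.exp (672 / δ * ‖z - w‖) * ‖g w‖ := by
  obtain ⟨h, hd, hexp⟩ := hg.exists_exp_eq_on_ball h0
  have hsub : closedBall (0 : ℂ) (1 - δ) ⊆ ball 0 1 := closedBall_subset_ball (by linarith)
  have hz' : z ∈ closedBall (0 : ℂ) (1 - δ) := by simpa using hz
  have hw' : w ∈ closedBall (0 : ℂ) (1 - δ) := by simpa using hw
  have hder : ∀ x ∈ closedBall (0 : ℂ) (1 - δ), ‖deriv h x‖ ≤ 672 / δ := by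
    intro x hx
    have hball : ball x δ ⊆ ball 0 1 := ball_subset_ball' (by
      have := mem_closedBall.1 hx
      linarith)
    refine norm_deriv_le_of_injOn_exp hδ (hd.mono hball) ?_
    intro a ha b hb hab
    refine hinj (hball ha) (hball hb) ?_
    rw [← hexp a (hball ha), ← hexp b (hball hb)]
    exact hab
  have hlip := (convex_closedBall (0 : ℂ) (1 - δ)).norm_image_sub_le_of_norm_deriv_le
    (fun x hx => hd.differentiableAt (isOpen_ball.mem_nhds (hsub hx))) hder hw' hz'
  rw [← hexp z (hsub hz'), ← hexp w (hsub hw'), Complex.norm_exp, Complex.norm_exp, ← Real.exp_add]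
  gcongr
  have := (Complex.re_le_norm (h z - h w)).trans hlip
  rw [Complex.sub_re] at this
  linarith

/-- An injective holomorphic function on the unit disc is proper onto its image: limits of `f`
along sequences tending to the unit circle are not attained. -/
theorem notMem_image_of_tendsto_of_norm_eq_one {f : ℂ → ℂ} (hf : DifferentiableOn ℂ f (ball 0 1))
    (hinj : Set.InjOn f (ball 0 1)) {u : ℕ → ℂ} {a w : ℂ} (hu : ∀ n, u n ∈ ball (0 : ℂ) 1)
    (ha : ‖a‖ = 1) (hua : Tendsto u atTop (𝓝 a)) (hfu : Tendsto (fun n => f (u n)) atTop (𝓝 w)) :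
    w ∉ f '' ball 0 1 := by
  rintro ⟨q, hq, rfl⟩
  have hq1 : ‖q‖ < 1 := by simpa using hq
  have hopen : ∀ s ⊆ ball (0 : ℂ) 1, IsOpen s → IsOpen (f '' s) := by
    refine ((hf.analyticOnNhd isOpen_ball).is_constant_or_isOpen
      (convex_ball _ _).isPreconnected).resolve_left ?_
    rintro ⟨v, hv⟩
    have h0 : (0 : ℂ) ∈ ball (0 : ℂ) 1 := by simp
    have h1 : (1 / 2 : ℂ) ∈ ball (0 : ℂ) 1 := by simp; norm_num
    have := hinj h0 h1 ((hv _ h0).trans (hv _ h1).symm)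
    norm_num at this
  set ρ := (1 + ‖q‖) / 2 with hρ
  have hsub : ball (0 : ℂ) ρ ⊆ ball 0 1 := ball_subset_ball (by linarith)
  have hmem : f '' ball 0 ρ ∈ 𝓝 (f q) :=
    (hopen _ hsub isOpen_ball).mem_nhds ⟨q, by simp; linarith, rfl⟩
  have hle : ‖a‖ ≤ ρ := by
    refine le_of_tendsto hua.norm ?_
    filter_upwards [hfu hmem] with n hn
    obtain ⟨y, hy, hyn⟩ := hn
    rw [← hinj (hsub hy) (hu n) hyn]
    exact (mem_ball_zero_iff.1 hy).le
  linarith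

/-- A bounded univalent image of a radial segment comes within its own diameter of a point
outside the image of the disc. -/
theorem exists_notMem_image_forall_dist_le_diam {f : ℂ → ℂ}
    (hf : DifferentiableOn ℂ f (ball 0 1)) (hinj : Set.InjOn f (ball 0 1)) {r : ℝ} (hr : 0 < r)
    (hr1 : r < 1) (hb : Bornology.IsBounded (f '' radialSeg r)) :
    ∃ w, w ∉ f '' ball 0 1 ∧ ∀ z ∈ radialSeg r, dist (f z) w ≤ diam (f '' radialSeg r) := by
  obtain ⟨u, -, hu, hlim⟩ := exists_seq_strictMono_tendsto' (show 1 - r < 1 by linarith)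
  have hmem : ∀ n, (u n : ℂ) ∈ radialSeg r := fun n => ⟨u n, (hu n).1.le, (hu n).2, rfl⟩
  have hball : ∀ n, (u n : ℂ) ∈ ball (0 : ℂ) 1 := fun n => by
    rw [mem_ball_zero_iff, Complex.norm_real, Real.norm_eq_abs, abs_lt]
    constructor <;> linarith [(hu n).1, (hu n).2]
  obtain ⟨w, -, φ, hφ, hw⟩ := tendsto_subseq_of_bounded hb
    (fun n => Set.mem_image_of_mem f (hmem n))
  refine ⟨w, notMem_image_of_tendsto_of_norm_eq_one hf hinj (u := fun n => (u (φ n) : ℂ)) (a := 1)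
    (fun n => hball _) (by simp) ?_ hw, fun z hz => ?_⟩
  · exact_mod_cast (Complex.continuous_ofReal.tendsto 1).comp (hlim.comp hφ.tendsto_atTop)
  · exact le_of_tendsto (tendsto_const_nhds.dist hw) (Eventually.of_forall fun n =>
      dist_le_diam_of_mem hb (Set.mem_image_of_mem f hz) (Set.mem_image_of_mem f (hmem _)))

/-- The Stolz cone stays away from the unit circle, up to a multiple of the distance to its apex. -/
theorem norm_one_sub_mul_exp_le {ρ θ : ℝ} (hρ : 0 ≤ ρ) (hρ1 : ρ ≤ 1) (hθ : -(Real.pi / 4) ≤ θ)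
    (hθ' : θ ≤ Real.pi / 4) : ‖1 - ρ * Complex.exp (θ * Complex.I)‖ ≤ 1 - ρ / 5 := by
  have hcos : 7 / 10 ≤ Real.cos θ := by
    have h1 : Real.cos (Real.pi / 4) ≤ Real.cos |θ| :=
      Real.cos_le_cos_of_nonneg_of_le_pi (abs_nonneg _) (by linarith [Real.pi_pos])
        (abs_le.2 ⟨hθ, hθ'⟩)
    rw [Real.cos_abs, Real.cos_pi_div_four] at h1
    have : (14 / 10 : ℝ) ≤ √2 := Real.le_sqrt_of_sq_le (by norm_num)
    linarith
  have hsq : ‖1 - ρ * Complex.exp (θ * Complex.I)‖ ^ 2 = 1 - 2 * ρ * Real.cos θ + ρ ^ 2 := by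
    rw [Complex.sq_norm, Complex.normSq_apply]
    simp only [Complex.sub_re, Complex.sub_im, Complex.one_re, Complex.one_im,
      Complex.re_ofReal_mul, Complex.im_ofReal_mul, Complex.exp_ofReal_mul_I_re,
      Complex.exp_ofReal_mul_I_im]
    linear_combination ρ ^ 2 * Real.sin_sq_add_cos_sq θ
  refine le_of_sq_le_sq ?_ (by linarith)
  rw [hsq]
  nlinarith [mul_le_mul_of_nonneg_left hcos hρ]

theorem stmt_10 :
    ∃ c : ℝ, 0 < c ∧
      ∀ (f : ℂ → ℂ) (D : Set ℂ),
        DifferentiableOn ℂ f (Metric.ball 0 1) →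
        Set.InjOn f (Metric.ball 0 1) →
        f '' Metric.ball 0 1 = D →
        f 0 = 0 → (deriv f 0).im = 0 → 0 < (deriv f 0).re →
        ∀ r : ℝ, 0 < r → r < 1 →
          Metric.diam (f '' (stolzCone r ∩ Metric.ball 0 1))
            ≤ c * Metric.diam (f '' radialSeg r) := by
  refine ⟨2 * Real.exp 6720, by positivity, fun f D hf hinj _ _ _ _ r hr hr1 => ?_⟩
  by_cases hb : Bornology.IsBounded (f '' radialSeg r)
  · obtain ⟨w, hw, hdist⟩ := exists_notMem_image_forall_dist_le_diam hf hinj hr hr1 hb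
    have hcone : ∀ z ∈ stolzCone r ∩ ball 0 1,
        dist (f z) w ≤ Real.exp 6720 * diam (f '' radialSeg r) := by
      rintro z ⟨⟨ρ, θ, hρ, hρr, hθ, hθ', rfl⟩, hz⟩
      rcases hρ.eq_or_lt with rfl | hρ
      · simp at hz
      have hnorm := norm_one_sub_mul_exp_le hρ.le (by linarith) hθ hθ'
      have hnorm' : ‖((1 - ρ : ℝ) : ℂ)‖ ≤ 1 - ρ / 5 := by
        rw [Complex.norm_real, Real.norm_eq_abs, abs_of_nonneg (by linarith)]
        linarith
      have hsub : ‖(1 - ρ * Complex.exp (θ * Complex.I)) - ((1 - ρ : ℝ) : ℂ)‖ ≤ 2 * ρ := by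
        have h1 : (1 - ρ * Complex.exp (θ * Complex.I)) - ((1 - ρ : ℝ) : ℂ)
            = ρ * (1 - Complex.exp (θ * Complex.I)) := by push_cast; ring
        have h2 := norm_sub_le 1 (Complex.exp (θ * Complex.I))
        rw [Complex.norm_exp_ofReal_mul_I, norm_one] at h2
        rw [h1, norm_mul, Complex.norm_real, Real.norm_eq_abs, abs_of_pos hρ]
        nlinarith
      have hmain := norm_le_exp_mul_norm_of_injOn (g := fun z => f z - w) (hf.sub_const w)
        (fun a ha b hb hab => hinj ha hb (sub_left_injective hab))
        (fun a ha hab => hw ⟨a, ha, sub_eq_zero.1 hab⟩) (by positivity : 0 < ρ / 5) hnorm hnorm'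
      rw [dist_eq_norm]
      refine hmain.trans ?_
      gcongr
      · calc 672 / (ρ / 5) * _ ≤ 672 / (ρ / 5) * (2 * ρ) := by gcongr
          _ = 6720 := by field_simp; norm_num
      · rw [← dist_eq_norm]
        exact hdist _ ⟨1 - ρ, by linarith, by linarith, rfl⟩
    refine diam_le_of_forall_dist_le (by positivity) ?_
    rintro _ ⟨x, hx, rfl⟩ _ ⟨y, hy, rfl⟩
    have := dist_triangle_right (f x) (f y) w
    linarith [hcone x hx, hcone y hy]
  · have hsub : radialSeg r ⊆ stolzCone r ∩ ball 0 1 := by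
      rintro _ ⟨s, hs, hs1, rfl⟩
      refine ⟨⟨1 - s, 0, by linarith, by linarith, by linarith [Real.pi_pos],
        by linarith [Real.pi_pos], by simp⟩, ?_⟩
      rw [mem_ball_zero_iff, Complex.norm_real, Real.norm_eq_abs, abs_lt]
      constructor <;> linarith
    rw [diam_eq_zero_of_unbounded hb,
      diam_eq_zero_of_unbounded fun h => hb (h.subset (Set.image_mono hsub)), mul_zero]
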